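/- arXiv:1407.2293 — 2 statements merged into one kernel-verified Lean document; each statement's English description precedes it below -/
import Mathlib

section
/- Let K be a field, Λ a finite-dimensional K-algebra with Jacobson radical J, and e ∈ Λ an idempotent. Let p_0 = e, p_1, …, p_l be K-linearly independent elements of Λ such that for each 0 ≤ i < l there exists γ ∈ J with p_{i+1} = γ·p_i, and let A = span_K{p_0, …, p_l}. If C is a left Λ-submodule of Λe such that Λe = A ⊕ C as K-vector spaces (i.e., A ∩ C = 0 and A + C = Λe), then the quotient module M = Λe/C is uniserial, J^i·M equals the Λ-submodule generated by p_i + C for every 0 ≤ i ≤ l (so dim_K J^i·M = l+1−i), and J^{l+1}·M = 0. -/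
/-- A relative form of Nakayama's lemma for modules over noncommutative rings. -/
theorem Submodule.FG.le_of_le_sup_jacobson_smul {R M : Type*} [Ring R] [AddCommGroup M]
    [Module R M] {N F : Submodule R M} (hF : F.FG) (h : F ≤ N ⊔ Ring.jacobson R • F) : F ≤ N := by
  have key : F.map N.mkQ = ⊥ := by
    refine (hF.map N.mkQ).eq_bot_of_le_jacobson_smul ?_
    rw [← Submodule.map_smul'']
    refine (Submodule.map_mono h).trans ?_
    simp [Submodule.map_sup]
  rwa [← le_bot_iff, Submodule.map_le_iff_le_comap, Submodule.comap_bot, Submodule.ker_mkQ] at key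

section RadicalChain

variable {K Λ M : Type*} [Field K] [Ring Λ] [Algebra K Λ] [AddCommGroup M] [Module K M]
  [Module Λ M] [IsScalarTower K Λ M] [FiniteDimensional K M]

variable (Λ M) in
/-- The `n`-th term of the radical filtration of `M`. -/
def radicalLayer (n : ℕ) : Submodule Λ M := Ring.jacobson Λ ^ n • ⊤

theorem radicalLayer_zero : radicalLayer Λ M 0 = ⊤ := by
  rw [radicalLayer, Submodule.pow_zero, Submodule.one_smul]

theorem radicalLayer_succ (n : ℕ) :
    radicalLayer Λ M (n + 1) = Ring.jacobson Λ • radicalLayer Λ M n := by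
  rcases eq_or_ne n 0 with rfl | hn
  · rw [radicalLayer_zero, radicalLayer, zero_add, Submodule.pow_one]
  · rw [radicalLayer, radicalLayer, Submodule.pow_succ' _ hn]
    exact Submodule.smul_assoc _ _ _

theorem radicalLayer_antitone : Antitone (radicalLayer Λ M) :=
  antitone_nat_of_succ_le fun n => by
    rw [radicalLayer_succ]
    exact Submodule.smul_le_right

include K in
theorem Submodule.fg_of_finiteDimensional (N : Submodule Λ M) : N.FG := by
  have : IsNoetherian Λ M := isNoetherian_of_tower K inferInstance
  exact IsNoetherian.noetherian N

theorem finrank_radicalLayer_le (n : ℕ) :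
    Module.finrank K (radicalLayer Λ M n) ≤ Module.finrank K M - n := by
  induction n with
  | zero => exact Submodule.finrank_le ((radicalLayer Λ M 0).restrictScalars K)
  | succ n ih =>
    by_cases h : radicalLayer Λ M n = ⊥
    · have : radicalLayer Λ M (n + 1) = ⊥ :=
        le_bot_iff.mp (h ▸ radicalLayer_antitone n.le_succ)
      rw [this]
      exact (finrank_bot K M).trans_le (Nat.zero_le _)
    · have hlt : radicalLayer Λ M (n + 1) < radicalLayer Λ M n := by
        rw [radicalLayer_succ]
        exact Submodule.FG.jacobson_smul_lt h (Submodule.fg_of_finiteDimensional (K := K) _)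
      have : Module.finrank K (radicalLayer Λ M (n + 1)) <
          Module.finrank K (radicalLayer Λ M n) :=
        Submodule.finrank_lt_finrank_of_lt
          (s := (radicalLayer Λ M (n + 1)).restrictScalars K)
          (t := (radicalLayer Λ M n).restrictScalars K) hlt
      omega

theorem radicalLayer_eq_bot {n : ℕ} (hn : Module.finrank K M ≤ n) : radicalLayer Λ M n = ⊥ := by
  have h := finrank_radicalLayer_le (K := K) (Λ := Λ) (M := M) n
  rw [Nat.sub_eq_zero_of_le hn, Nat.le_zero] at h
  have := Submodule.finrank_eq_zero (S := (radicalLayer Λ M n).restrictScalars K) |>.mp h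
  simpa using this

/-- If each layer of the radical filtration has codimension at most one in the previous one,
every submodule is a layer. -/
theorem exists_eq_radicalLayer
    (h : ∀ n, Module.finrank K (radicalLayer Λ M n) ≤
      Module.finrank K (radicalLayer Λ M (n + 1)) + 1)
    (N : Submodule Λ M) : ∃ n, N = radicalLayer Λ M n := by
  by_contra! hne
  have hle : ∀ n, N ≤ radicalLayer Λ M n := by
    intro n
    induction n with
    | zero => simp [radicalLayer_zero]
    | succ n ih =>
      by_contra hN
      refine hne n (le_antisymm ih ?_)
      have hlt : radicalLayer Λ M (n + 1) < N ⊔ radicalLayer Λ M (n + 1) := by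
        rwa [right_lt_sup]
      have hfin : Module.finrank K (radicalLayer Λ M (n + 1)) <
          Module.finrank K ↥(N ⊔ radicalLayer Λ M (n + 1)) :=
        Submodule.finrank_lt_finrank_of_lt
          (s := (radicalLayer Λ M (n + 1)).restrictScalars K)
          (t := (N ⊔ radicalLayer Λ M (n + 1)).restrictScalars K) hlt
      have heq : (N ⊔ radicalLayer Λ M (n + 1)).restrictScalars K =
          (radicalLayer Λ M n).restrictScalars K :=
        Submodule.eq_of_le_of_finrank_le (sup_le ih (radicalLayer_antitone n.le_succ))
          ((h n).trans hfin)
      refine (Submodule.fg_of_finiteDimensional (K := K) _).le_of_le_sup_jacobson_smul ?_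
      rw [← radicalLayer_succ]
      exact (Submodule.restrictScalars_injective K Λ M heq).ge
  exact hne (Module.finrank K M) (le_antisymm (hle _) (by simp [radicalLayer_eq_bot le_rfl]))

variable {l : ℕ} {b : Fin (l + 1) → M}

theorem mem_radicalLayer_of_step
    (hstep : ∀ i : Fin l, ∃ γ ∈ Ring.jacobson Λ, b i.succ = γ • b i.castSucc) (i : Fin (l + 1)) :
    b i ∈ radicalLayer Λ M i := by
  induction i using Fin.induction with
  | zero => simp [radicalLayer_zero]
  | succ i ih =>
    obtain ⟨γ, hγ, h⟩ := hstep i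
    rw [h, Fin.val_succ, radicalLayer_succ]
    exact Submodule.smul_mem_smul hγ ih

theorem mem_span_singleton_of_step
    (hstep : ∀ i : Fin l, ∃ γ ∈ Ring.jacobson Λ, b i.succ = γ • b i.castSucc)
    {i j : Fin (l + 1)} (hij : i ≤ j) : b j ∈ Submodule.span Λ {b i} := by
  induction j using Fin.induction with
  | zero =>
    rw [Fin.le_zero_iff.mp hij]
    exact Submodule.mem_span_singleton_self _
  | succ j ih =>
    rcases hij.eq_or_lt with rfl | hlt
    · exact Submodule.mem_span_singleton_self _
    · obtain ⟨γ, -, h⟩ := hstep j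
      rw [h]
      exact Submodule.smul_mem _ _ (ih (Fin.le_castSucc_iff.mpr hlt))

theorem le_finrank_span_singleton_of_step (hli : LinearIndependent K b)
    (hstep : ∀ i : Fin l, ∃ γ ∈ Ring.jacobson Λ, b i.succ = γ • b i.castSucc) (i : Fin (l + 1)) :
    l + 1 - (i : ℕ) ≤ Module.finrank K (Submodule.span Λ {b i}) := by
  have hcard : Module.finrank K (Submodule.span K (Set.range fun j : Finset.Ici i => b j)) =
      l + 1 - (i : ℕ) := by
    refine (finrank_span_eq_card (hli.comp _ Subtype.val_injective)).trans ?_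
    rw [Fintype.card_coe, Fin.card_Ici]
  rw [← hcard]
  refine Submodule.finrank_mono (t := (Submodule.span Λ {b i}).restrictScalars K)
    (Submodule.span_le.mpr ?_)
  rintro _ ⟨j, rfl⟩
  exact mem_span_singleton_of_step hstep (Finset.mem_Ici.mp j.2)

theorem radicalLayer_eq_span_singleton (hli : LinearIndependent K b)
    (hdim : Module.finrank K M = l + 1)
    (hstep : ∀ i : Fin l, ∃ γ ∈ Ring.jacobson Λ, b i.succ = γ • b i.castSucc) (i : Fin (l + 1)) :
    radicalLayer Λ M i = Submodule.span Λ {b i} := by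
  have heq : (Submodule.span Λ {b i}).restrictScalars K =
      (radicalLayer Λ M i).restrictScalars K := by
    refine Submodule.eq_of_le_of_finrank_le ?_ ?_
    · exact (Submodule.span_singleton_le_iff_mem _ _).mpr (mem_radicalLayer_of_step hstep i)
    · exact (hdim ▸ finrank_radicalLayer_le (K := K) (Λ := Λ) (M := M) i).trans
        (le_finrank_span_singleton_of_step hli hstep i)
  exact (Submodule.restrictScalars_injective K Λ M heq).symm

theorem finrank_radicalLayer (hli : LinearIndependent K b)
    (hdim : Module.finrank K M = l + 1)
    (hstep : ∀ i : Fin l, ∃ γ ∈ Ring.jacobson Λ, b i.succ = γ • b i.castSucc) (n : ℕ) :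
    Module.finrank K (radicalLayer Λ M n) = l + 1 - n := by
  refine le_antisymm (hdim ▸ finrank_radicalLayer_le n) ?_
  rcases lt_or_ge n (l + 1) with hn | hn
  · have := le_finrank_span_singleton_of_step hli hstep ⟨n, hn⟩
    rwa [← radicalLayer_eq_span_singleton hli hdim hstep] at this
  · simp [Nat.sub_eq_zero_of_le hn]

end RadicalChain


/-- Let `K` be a field, `Λ` a finite-dimensional `K`-algebra with
Jacobson radical `J`, and `e ∈ Λ` an idempotent.  Let `p 0 = e, p 1, …, p l` be
`K`-linearly independent elements of `Λ` such that each `p (i+1) = γ * p i` for some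
`γ ∈ J`, and let `A` be their `K`-span.  If `C` is a left `Λ`-submodule of `Λe` with
`Λe = A ⊕ C` as `K`-vector spaces, then `M = Λe/C` is uniserial,
`J^i • M = Λ·(p i + C)` for all `0 ≤ i ≤ l` (so `dim_K J^i • M = l + 1 - i`), and
`J^(l+1) • M = 0`. -/
theorem uniserial_of_complement
    (K Λ : Type*) [Field K] [Ring Λ] [Algebra K Λ] [FiniteDimensional K Λ]
    (J : Ideal Λ) (hJ : J = Ideal.jacobson (⊥ : Ideal Λ))
    (e : Λ) (he : IsIdempotentElem e)
    (l : ℕ) (p : Fin (l + 1) → Λ) (hp0 : p 0 = e)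
    (hli : LinearIndependent K p)
    (hstep : ∀ i : Fin l, ∃ γ ∈ J, p i.succ = γ * p i.castSucc)
    (E : Ideal Λ) (hE : E = Ideal.span {e})
    (hpE : ∀ i, p i ∈ E)
    (A : Submodule K Λ) (hA : A = Submodule.span K (Set.range p))
    (C : Ideal Λ) (hCE : C ≤ E)
    (hdisj : A ⊓ C.restrictScalars K = ⊥)
    (hsum : A ⊔ C.restrictScalars K = E.restrictScalars K) :
    (∀ N N' : Submodule Λ (↥E ⧸ Submodule.comap (Submodule.subtype E) C), N ≤ N' ∨ N' ≤ N) ∧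
    (∀ i : Fin (l + 1),
      (J ^ (i : ℕ) • ⊤ : Submodule Λ (↥E ⧸ Submodule.comap (Submodule.subtype E) C)) =
        Submodule.span Λ {Submodule.Quotient.mk ⟨p i, hpE i⟩}) ∧
    (∀ i : Fin (l + 1),
      Module.finrank K (J ^ (i : ℕ) • ⊤ : Submodule Λ (↥E ⧸ Submodule.comap (Submodule.subtype E) C)) =
        l + 1 - (i : ℕ)) ∧
    (J ^ (l + 1) • ⊤ : Submodule Λ (↥E ⧸ Submodule.comap (Submodule.subtype E) C)) = ⊥ := by
  rw [Ideal.jacobson_bot] at hJ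
  subst hJ
  set D := Submodule.comap (Submodule.subtype E) C with hD
  let π : ↥E →ₗ[K] ↥E ⧸ D := D.mkQ.restrictScalars K
  let q : Fin (l + 1) → ↥E := fun i => ⟨p i, hpE i⟩
  have : FiniteDimensional K ↥E :=
    inferInstanceAs (FiniteDimensional K (E.restrictScalars K))
  have hπ : Function.Surjective π := D.mkQ_surjective
  have : FiniteDimensional K (↥E ⧸ D) := Module.Finite.of_surjective π hπ
  let ι : ↥E →ₗ[K] Λ := (Submodule.subtype E).restrictScalars K
  have hspan : (Submodule.span K (Set.range q)).map ι = A := by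
    rw [hA, Submodule.map_span, ← Set.range_comp]
    rfl
  have hq : LinearIndependent K q := LinearIndependent.of_comp ι hli
  have hb : LinearIndependent K (π ∘ q) := by
    refine hq.map ?_
    rw [Submodule.disjoint_def]
    intro x hx hx0
    have hxC : (x : Λ) ∈ C := (Submodule.Quotient.mk_eq_zero D).mp hx0
    have hxA : (x : Λ) ∈ A := hspan ▸ Submodule.mem_map_of_mem (f := ι) hx
    have : (x : Λ) ∈ A ⊓ C.restrictScalars K := ⟨hxA, hxC⟩
    rw [hdisj, Submodule.mem_bot] at this
    exact Subtype.ext this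
  have htop : Submodule.span K (Set.range (π ∘ q)) = ⊤ := by
    rw [eq_top_iff]
    rintro y -
    obtain ⟨x, rfl⟩ := hπ y
    have hx : (x : Λ) ∈ A ⊔ C.restrictScalars K := by rw [hsum]; exact x.2
    obtain ⟨a, ha, c, hc, hac⟩ := Submodule.mem_sup.mp hx
    rw [← hspan] at ha
    obtain ⟨a, ha, rfl⟩ := ha
    have hxa : π x = π a := by
      refine (Submodule.Quotient.eq D).mpr ?_
      change (x : Λ) - (a : Λ) ∈ C
      rw [← hac]
      change (a : Λ) + c - a ∈ C
      simpa using hc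
    rw [hxa, Set.range_comp, ← Submodule.map_span]
    exact Submodule.mem_map_of_mem ha
  have hdim : Module.finrank K (↥E ⧸ D) = l + 1 := by
    rw [← finrank_top, ← htop, finrank_span_eq_card hb, Fintype.card_fin]
  have hbstep : ∀ i : Fin l, ∃ γ ∈ Ring.jacobson Λ,
      (π ∘ q) i.succ = γ • (π ∘ q) i.castSucc := by
    intro i
    obtain ⟨γ, hγ, h⟩ := hstep i
    refine ⟨γ, hγ, ?_⟩
    have : q i.succ = γ • q i.castSucc := Subtype.ext h
    change D.mkQ (q i.succ) = γ • D.mkQ (q i.castSucc)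
    rw [this, map_smul]
  have hfin := finrank_radicalLayer hb hdim hbstep
  refine ⟨fun N N' => ?_, radicalLayer_eq_span_singleton hb hdim hbstep, fun i => hfin i,
    radicalLayer_eq_bot hdim.le⟩
  have hcodim (n : ℕ) : Module.finrank K (radicalLayer Λ (↥E ⧸ D) n) ≤
      Module.finrank K (radicalLayer Λ (↥E ⧸ D) (n + 1)) + 1 := by
    rw [hfin, hfin]
    omega
  obtain ⟨m, rfl⟩ := exists_eq_radicalLayer hcodim N
  obtain ⟨n, rfl⟩ := exists_eq_radicalLayer hcodim N'
  exact (le_total n m).imp (radicalLayer_antitone ·) (radicalLayer_antitone ·)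
end

section
/- Let K be an algebraically closed field, Λ a finite-dimensional K-algebra, and let U and U' be finite-dimensional uniserial left Λ-modules. If U degenerates to U', i.e., if there exists a finite-dimensional left Λ-module Z and a short exact sequence 0 → Z → Z ⊕ U → U' → 0 of Λ-modules, then U ≅ U'. In other words, a uniserial module admits no degeneration to a non-isomorphic uniserial module. -/
/-- A module is uniserial if its submodules are totally ordered by inclusion. -/
def IsUniserialModule (Λ M : Type*) [Ring Λ] [AddCommGroup M] [Module Λ M] : Prop :=
  ∀ N N' : Submodule Λ M, N ≤ N' ∨ N' ≤ N

/-- Spaces of `Λ`-linear maps between finite-dimensional modules are finite-dimensional. -/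
theorem finiteDimensional_linearMap_of_algebra (K Λ : Type*) [Field K] [Ring Λ] [Algebra K Λ]
    (X Y : Type*) [AddCommGroup X] [Module K X] [Module Λ X] [IsScalarTower K Λ X]
    [FiniteDimensional K X] [AddCommGroup Y] [Module K Y] [Module Λ Y] [IsScalarTower K Λ Y]
    [FiniteDimensional K Y] : FiniteDimensional K (X →ₗ[Λ] Y) :=
  Module.Finite.of_injective (LinearMap.restrictScalarsₗ K Λ X Y K)
    (LinearMap.restrictScalars_injective K)

open Module in
/-- Covariant `Hom`-dimensions do not drop from `U` to `U'` along a left exact sequence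
`0 → Z → Z × U → U'`. -/
theorem finrank_hom_le_of_exact (K : Type*) {Λ : Type*} [Field K] [Ring Λ] [Algebra K Λ]
    (X : Type*) [AddCommGroup X] [Module K X] [Module Λ X] [IsScalarTower K Λ X]
    [FiniteDimensional K X]
    {U : Type*} [AddCommGroup U] [Module K U] [Module Λ U] [IsScalarTower K Λ U]
    [FiniteDimensional K U]
    {U' : Type*} [AddCommGroup U'] [Module K U'] [Module Λ U'] [IsScalarTower K Λ U']
    [FiniteDimensional K U']
    {Z : Type*} [AddCommGroup Z] [Module K Z] [Module Λ Z] [IsScalarTower K Λ Z]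
    [FiniteDimensional K Z]
    (f : Z →ₗ[Λ] Z × U) (g : Z × U →ₗ[Λ] U')
    (hf : Function.Injective f) (hfg : LinearMap.range f = LinearMap.ker g) :
    finrank K (X →ₗ[Λ] U) ≤ finrank K (X →ₗ[Λ] U') := by
  have := finiteDimensional_linearMap_of_algebra K Λ X U
  have := finiteDimensional_linearMap_of_algebra K Λ X U'
  have := finiteDimensional_linearMap_of_algebra K Λ X Z
  have := finiteDimensional_linearMap_of_algebra K Λ X (Z × U)
  let F : (X →ₗ[Λ] Z) →ₗ[K] (X →ₗ[Λ] Z × U) := LinearMap.compRight K f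
  let G : (X →ₗ[Λ] Z × U) →ₗ[K] (X →ₗ[Λ] U') := LinearMap.compRight K g
  have hker : LinearMap.ker G ≤ LinearMap.range F := by
    intro φ hφ
    have hφ' (x : X) : φ x ∈ LinearMap.range f := by
      rw [hfg]
      exact LinearMap.congr_fun hφ x
    refine ⟨(LinearEquiv.ofInjective f hf).symm.toLinearMap ∘ₗ φ.codRestrict _ hφ', ?_⟩
    ext1 x
    exact congrArg Subtype.val ((LinearEquiv.ofInjective f hf).apply_symm_apply ⟨φ x, hφ' x⟩)
  have h₁ := LinearMap.finrank_range_add_finrank_ker G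
  have h₂ := Submodule.finrank_mono hker
  have h₃ := LinearMap.finrank_range_le F
  have h₄ := Submodule.finrank_le (LinearMap.range G)
  have h₅ := (LinearMap.prodEquiv (M := X) (M₂ := Z) (M₃ := U) (R := Λ) K).finrank_eq
  rw [finrank_prod] at h₅
  omega

/-- The radical `J • U` of a nonzero uniserial module over an Artinian ring is maximal. -/
theorem IsUniserialModule.isCoatom_jacobson_smul_top {Λ U : Type*} [Ring Λ] [IsArtinianRing Λ]
    [AddCommGroup U] [Module Λ U] [Module.Finite Λ U] [Nontrivial U]
    (hU : IsUniserialModule Λ U) : IsCoatom (Ring.jacobson Λ • (⊤ : Submodule Λ U)) := by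
  have hne : Ring.jacobson Λ • (⊤ : Submodule Λ U) ≠ ⊤ := (Submodule.jacobson_smul_lt_top _).ne
  have htors : Module.IsTorsionBySet Λ (U ⧸ Ring.jacobson Λ • (⊤ : Submodule Λ U))
      (Ring.jacobson Λ) :=
    (Module.isTorsionBySet_quotient_iff _ _).2
      fun _ _ hr ↦ Submodule.smul_mem_smul hr Submodule.mem_top
  let _ := htors.module
  have hss : IsSemisimpleModule Λ (U ⧸ Ring.jacobson Λ • (⊤ : Submodule Λ U)) :=
    htors.isSemisimpleModule_iff.1 inferInstance
  refine ⟨hne, fun N hN ↦ ?_⟩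
  obtain ⟨C, hC⟩ := exists_isCompl (N.map (Ring.jacobson Λ • (⊤ : Submodule Λ U)).mkQ)
  have hcomap : (N.map (Ring.jacobson Λ • (⊤ : Submodule Λ U)).mkQ).comap
      (Ring.jacobson Λ • (⊤ : Submodule Λ U)).mkQ = N := by
    rw [Submodule.comap_map_mkQ, sup_eq_right.2 hN.le]
  have hsurj := Submodule.mkQ_surjective (Ring.jacobson Λ • (⊤ : Submodule Λ U))
  rcases hU N (C.comap (Ring.jacobson Λ • (⊤ : Submodule Λ U)).mkQ) with h | h
  · have hbot : N.map (Ring.jacobson Λ • (⊤ : Submodule Λ U)).mkQ = ⊥ :=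
      hC.disjoint.eq_bot_of_le (Submodule.map_le_iff_le_comap.2 h)
    rw [hbot, Submodule.comap_bot, Submodule.ker_mkQ] at hcomap
    exact absurd hcomap hN.ne
  · rw [← hcomap, Submodule.comap_le_comap_iff_of_surjective hsurj] at h
    have htop : N.map (Ring.jacobson Λ • (⊤ : Submodule Λ U)).mkQ = ⊤ :=
      hC.codisjoint.symm.eq_top_of_ge h
    rw [← hcomap, htop, Submodule.comap_top]

/-- Submodules of uniserial modules are uniserial. -/
theorem IsUniserialModule.submodule {Λ U : Type*} [Ring Λ] [AddCommGroup U] [Module Λ U]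
    (hU : IsUniserialModule Λ U) (N : Submodule Λ U) : IsUniserialModule Λ N := fun A B ↦
  (hU (A.map N.subtype) (B.map N.subtype)).imp
    (Submodule.map_le_map_iff_of_injective N.injective_subtype A B).1
    (Submodule.map_le_map_iff_of_injective N.injective_subtype B A).1

/-- Passing from a module to a maximal submodule lowers the length by one. -/
theorem IsCoatom.length_add_one {R M : Type*} [Ring R] [AddCommGroup M] [Module R M]
    {N : Submodule R M} (hN : IsCoatom N) : Module.length R N + 1 = Module.length R M := by
  have := isSimpleModule_iff_isCoatom.2 hN
  rw [Module.length_eq_add_of_exact N.subtype N.mkQ N.injective_subtype N.mkQ_surjective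
    (LinearMap.exact_subtype_mkQ N), Module.length_eq_one R (M ⧸ N)]

/-- Linear maps carry `I • M` into `I • N`. -/
theorem LinearMap.map_mem_smul_top {R A B : Type*} [Ring R] [AddCommGroup A] [Module R A]
    [AddCommGroup B] [Module R B] (I : Ideal R) (h : A →ₗ[R] B) {x : A}
    (hx : x ∈ (I • ⊤ : Submodule R A)) : h x ∈ (I • ⊤ : Submodule R B) := by
  have := Submodule.mem_map_of_mem (f := h) hx
  rw [Submodule.map_smul''] at this
  exact (smul_mono_right I le_top : I • Submodule.map h ⊤ ≤ I • ⊤) this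

/-- A short exact sequence `0 → Z → Z × U → U' → 0` restricts to the submodules `I • ⊤` as soon
as `I • U` and `I • U'` have the same length. -/
theorem exists_exact_smul_top {Λ : Type*} [Ring Λ] (I : Ideal Λ)
    {U : Type*} [AddCommGroup U] [Module Λ U] [IsArtinian Λ U] [IsNoetherian Λ U]
    {U' : Type*} [AddCommGroup U'] [Module Λ U']
    {Z : Type*} [AddCommGroup Z] [Module Λ Z] [IsArtinian Λ Z] [IsNoetherian Λ Z]
    (f : Z →ₗ[Λ] Z × U) (g : Z × U →ₗ[Λ] U')
    (hf : Function.Injective f) (hg : Function.Surjective g)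
    (hfg : LinearMap.range f = LinearMap.ker g)
    (hlen : Module.length Λ (I • ⊤ : Submodule Λ U) = Module.length Λ (I • ⊤ : Submodule Λ U')) :
    ∃ (f₁ : (I • ⊤ : Submodule Λ Z) →ₗ[Λ] (I • ⊤ : Submodule Λ Z) × (I • ⊤ : Submodule Λ U))
      (g₁ : (I • ⊤ : Submodule Λ Z) × (I • ⊤ : Submodule Λ U) →ₗ[Λ] (I • ⊤ : Submodule Λ U')),
      Function.Injective f₁ ∧ Function.Surjective g₁ ∧
        LinearMap.range f₁ = LinearMap.ker g₁ := by
  let f₁ : (I • ⊤ : Submodule Λ Z) →ₗ[Λ] (I • ⊤ : Submodule Λ Z) × (I • ⊤ : Submodule Λ U) :=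
    ((LinearMap.fst Λ Z U ∘ₗ f).restrict fun _ ↦ LinearMap.map_mem_smul_top I _).prod
      ((LinearMap.snd Λ Z U ∘ₗ f).restrict fun _ ↦ LinearMap.map_mem_smul_top I _)
  let g₁ : (I • ⊤ : Submodule Λ Z) × (I • ⊤ : Submodule Λ U) →ₗ[Λ] (I • ⊤ : Submodule Λ U') :=
    ((g ∘ₗ LinearMap.inl Λ Z U).restrict fun _ ↦ LinearMap.map_mem_smul_top I _).coprod
      ((g ∘ₗ LinearMap.inr Λ Z U).restrict fun _ ↦ LinearMap.map_mem_smul_top I _)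
  have hf₁ (z) : (((f₁ z).1 : Z), ((f₁ z).2 : U)) = f z := rfl
  have hg₁ (w) : (g₁ w : U') = g ((w.1 : Z), (w.2 : U)) := by
    simp [g₁, ← map_add]
  have hf₁inj : Function.Injective f₁ := fun x y hxy ↦
    Subtype.ext (hf (by rw [← hf₁ x, ← hf₁ y, hxy]))
  have hg₁surj : Function.Surjective g₁ := by
    rintro ⟨y, hy⟩
    rw [← LinearMap.range_eq_top.2 hg, LinearMap.range_eq_map, ← Submodule.map_smul''] at hy
    obtain ⟨w, hw, rfl⟩ := hy
    exact ⟨(⟨w.1, LinearMap.map_mem_smul_top I (LinearMap.fst Λ Z U) hw⟩,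
      ⟨w.2, LinearMap.map_mem_smul_top I (LinearMap.snd Λ Z U) hw⟩), Subtype.ext (hg₁ _)⟩
  refine ⟨f₁, g₁, hf₁inj, hg₁surj, ?_⟩
  have hle : LinearMap.range f₁ ≤ LinearMap.ker g₁ := by
    rintro _ ⟨z, rfl⟩
    have hz : f z ∈ LinearMap.ker g := hfg ▸ LinearMap.mem_range_self f z.1
    exact Subtype.ext ((hg₁ _).trans ((congrArg g (hf₁ z)).trans hz))
  refine hle.eq_of_not_lt fun hlt ↦ (Submodule.height_strictMono hlt).ne ?_
  rw [← Module.length_submodule, ← Module.length_submodule,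
    ← (LinearEquiv.ofInjective f₁ hf₁inj).length_eq]
  have hlen₁ := Module.length_eq_add_of_exact (LinearMap.ker g₁).subtype g₁
    (Submodule.injective_subtype _) hg₁surj (LinearMap.exact_subtype_ker_map g₁)
  rw [Module.length_prod, ← hlen] at hlen₁
  exact (ENat.add_left_injective_of_ne_top Module.length_ne_top) hlen₁

/-- Let `K` be an algebraically closed field, `Λ` a finite-dimensional
`K`-algebra, and `U`, `U'` finite-dimensional uniserial left `Λ`-modules.  If `U`
degenerates to `U'`, i.e. there is a finite-dimensional `Λ`-module `Z` and a short exact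
sequence `0 → Z → Z ⊕ U → U' → 0`, then `U ≅ U'`. -/
theorem no_uniserial_degenerations
    (K Λ : Type*) [Field K] [IsAlgClosed K] [Ring Λ] [Algebra K Λ]
    [FiniteDimensional K Λ]
    (U : Type*) [AddCommGroup U] [Module K U] [Module Λ U] [IsScalarTower K Λ U]
    [FiniteDimensional K U]
    (U' : Type*) [AddCommGroup U'] [Module K U'] [Module Λ U'] [IsScalarTower K Λ U']
    [FiniteDimensional K U']
    (hU : IsUniserialModule Λ U) (hU' : IsUniserialModule Λ U')
    (Z : Type*) [AddCommGroup Z] [Module K Z] [Module Λ Z] [IsScalarTower K Λ Z]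
    [FiniteDimensional K Z]
    (f : Z →ₗ[Λ] Z × U) (g : Z × U →ₗ[Λ] U')
    (hf : Function.Injective f) (hg : Function.Surjective g)
    (hfg : LinearMap.range f = LinearMap.ker g) :
    Nonempty (U ≃ₗ[Λ] U') := by
  have : IsArtinianRing Λ := isArtinian_of_tower K inferInstance
  induction hn : Module.finrank K U using Nat.strong_induction_on generalizing U U' Z with
  | _ n ih =>
  have : Module.Finite Λ U := .of_restrictScalars_finite K Λ U
  have : Module.Finite Λ U' := .of_restrictScalars_finite K Λ U'
  have : Module.Finite Λ Z := .of_restrictScalars_finite K Λ Z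
  have hfin : Module.finrank K U = Module.finrank K U' := by
    have h₁ := LinearMap.finrank_range_add_finrank_ker (g.restrictScalars K)
    have h₂ : Module.finrank K (LinearMap.ker (g.restrictScalars K)) = Module.finrank K Z := by
      rw [← LinearMap.finrank_range_of_inj (f := f.restrictScalars K) hf]
      have : (LinearMap.range f).restrictScalars K = (LinearMap.ker g).restrictScalars K := by
        rw [hfg]
      exact congrArg (fun N : Submodule K (Z × U) ↦ Module.finrank K N) this.symm
    rw [LinearMap.range_eq_top.2 (show Function.Surjective (g.restrictScalars K) from hg),
      finrank_top, Module.finrank_prod] at h₁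
    omega
  have hlen : Module.length Λ U = Module.length Λ U' := by
    have h := Module.length_eq_add_of_exact f g hf hg (LinearMap.exact_iff.2 hfg.symm)
    rw [Module.length_prod] at h
    exact (ENat.add_right_injective_of_ne_top Module.length_ne_top) h
  cases subsingleton_or_nontrivial U with
  | inl hs =>
    have hs' : Subsingleton U' := by
      rw [← Module.length_eq_zero_iff (R := Λ), ← hlen, Module.length_eq_zero]
    exact ⟨0⟩
  | inr hnt =>
  have hnt' : Nontrivial U' := by
    rwa [← Module.length_pos_iff (R := Λ), ← hlen, Module.length_pos_iff]
  have hJ := hU.isCoatom_jacobson_smul_top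
  have hJ' := hU'.isCoatom_jacobson_smul_top
  set JU := Ring.jacobson Λ • (⊤ : Submodule Λ U)
  set JU' := Ring.jacobson Λ • (⊤ : Submodule Λ U')
  set JZ := Ring.jacobson Λ • (⊤ : Submodule Λ Z)
  obtain ⟨f₁, g₁, hf₁, hg₁, hfg₁⟩ := exists_exact_smul_top (Ring.jacobson Λ) f g hf hg hfg
    ((ENat.add_left_injective_of_ne_top ENat.one_ne_top)
      (hJ.length_add_one.trans (hlen.trans hJ'.length_add_one.symm)))
  have hfd : FiniteDimensional K JU := inferInstanceAs (FiniteDimensional K (JU.restrictScalars K))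
  have hfd' : FiniteDimensional K JU' :=
    inferInstanceAs (FiniteDimensional K (JU'.restrictScalars K))
  have hfdZ : FiniteDimensional K JZ := inferInstanceAs (FiniteDimensional K (JZ.restrictScalars K))
  have hlt : Module.finrank K JU < n := by
    rw [← hn]
    exact Submodule.finrank_lt (s := JU.restrictScalars K)
      fun h ↦ hJ.1 ((Submodule.restrictScalars_eq_top_iff K Λ U).1 h)
  obtain ⟨e⟩ := ih _ hlt JU JU' (hU.submodule _) (hU'.submodule _) JZ f₁ g₁ hf₁ hg₁ hfg₁ rfl
  by_contra hiso
  have hrange (φ : U →ₗ[Λ] U') (x : U) : φ x ∈ JU' := by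
    rcases hU' (LinearMap.range φ) JU' with h | h
    · exact h (LinearMap.mem_range_self φ x)
    rcases hJ'.le_iff.1 h with h | h
    · have hsurj : Function.Surjective φ := LinearMap.range_eq_top.1 h
      have hinj : Function.Injective φ :=
        (LinearMap.injective_iff_surjective_of_finrank_eq_finrank
          (f := φ.restrictScalars K) hfin).2 hsurj
      exact absurd ⟨LinearEquiv.ofBijective φ ⟨hinj, hsurj⟩⟩ hiso
    · exact h ▸ LinearMap.mem_range_self φ x
  have := finiteDimensional_linearMap_of_algebra K Λ U U
  have := finiteDimensional_linearMap_of_algebra K Λ U JU'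
  let A : (U →ₗ[Λ] JU') →ₗ[K] (U →ₗ[Λ] U') := LinearMap.compRight K JU'.subtype
  let B : (U →ₗ[Λ] JU') →ₗ[K] (U →ₗ[Λ] U) :=
    LinearMap.compRight K (JU.subtype ∘ₗ e.symm.toLinearMap)
  have hA : Function.Surjective A := fun φ ↦
    ⟨φ.codRestrict JU' (hrange φ), LinearMap.ext fun _ ↦ rfl⟩
  have hB : Function.Injective B := fun φ ψ h ↦ LinearMap.ext fun x ↦
    e.symm.injective (Subtype.ext (LinearMap.congr_fun h x))
  have hBtop : LinearMap.range B ≠ ⊤ := by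
    intro h
    obtain ⟨φ, hφ⟩ := LinearMap.range_eq_top.1 h LinearMap.id
    refine hJ.1 (eq_top_iff.2 fun x _ ↦ ?_)
    rw [← show B φ x = x from LinearMap.congr_fun hφ x]
    exact (e.symm (φ x)).2
  have h₁ := finrank_hom_le_of_exact K U f g hf hfg
  have h₂ := LinearMap.finrank_le_finrank_of_surjective hA
  have h₃ := Submodule.finrank_lt hBtop
  rw [LinearMap.finrank_range_of_inj hB] at h₃
  omega
end
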